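/- Let a > 0, L > 0, and ξ ∈ ℝ with 0 < |ξ| and |ξ| ≠ a. Then the improper integral lim_{T→∞} ∫_L^T cos(xξ)·J₀(a√(x²−L²)) dx exists, and it equals e^{−L√(a²−ξ²)}/√(a²−ξ²) if 0 < |ξ| < a, and −sin(L√(ξ²−a²))/√(ξ²−a²) if |ξ| > a. -/

import Mathlib

open MeasureTheory Metric Real Filter

noncomputable section

/-- The Bessel function of order zero, `J₀(z) = Σ_{k=0}^∞ (-1)^k z^{2k} / (2^{2k} (k!)²)`. -/
def J0 (z : ℝ) : ℝ :=
  ∑' k : ℕ, (-1 : ℝ) ^ k * z ^ (2 * k) / (2 ^ (2 * k) * ((Nat.factorial k : ℝ)) ^ 2)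

open scoped FourierTransform in
/-- The Riemann-Lebesgue lemma for the sine transform. -/
theorem tendsto_integral_mul_sin_atTop {f : ℝ → ℝ} (hf : Integrable f) :
    Tendsto (fun T : ℝ => ∫ u, f u * sin (T * u)) atTop (nhds 0) := by
  have hscale : Tendsto (fun T : ℝ => -(2 * π)⁻¹ * T) atTop (cocompact ℝ) :=
    (tendsto_id.const_mul_atTop_of_neg (by simp [pi_pos])).mono_right atBot_le_cocompact
  have h := (Real.tendsto_integral_exp_smul_cocompact (fun u => (f u : ℂ))).comp hscale
  have him := (Complex.continuous_im.tendsto 0).comp h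
  refine him.congr fun T => ?_
  have hint : Integrable (fun u : ℝ => 𝐞 (-(u * (-(2 * π)⁻¹ * T))) • (f u : ℂ)) := by
    simpa [mul_comm] using (Real.fourierIntegral_convergent_iff
      (f := fun u => (f u : ℂ)) (-(2 * π)⁻¹ * T)).2 hf.ofReal
  simp only [Function.comp_apply]
  rw [← RCLike.im_eq_complex_im, ← integral_im hint]
  refine integral_congr_ae (.of_forall fun u => ?_)
  have hphase : 2 * π * -(u * (-(2 * π)⁻¹ * T)) = T * u := by
    field_simp
  simp only [Circle.smul_def, Real.fourierChar_apply, hphase, smul_eq_mul]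
  rw [mul_comm]
  simp only [RCLike.im_eq_complex_im, Complex.im_ofReal_mul,
    Complex.exp_ofReal_mul_I_im]

theorem integral_integral_mul_cos {f : ℝ → ℝ} (hf : Integrable f) (T : ℝ) :
    ∫ t in 0..T, ∫ u, f u * cos (u * t) = ∫ u, f u / u * sin (T * u) := by
  rw [intervalIntegral_integral_swap]
  · have hne : ∀ᵐ u : ℝ, u ≠ 0 := by simp [ae_iff]
    refine integral_congr_ae ?_
    filter_upwards [hne] with u hu
    rw [intervalIntegral.integral_const_mul, intervalIntegral.integral_comp_mul_left _ hu]
    simp [mul_comm T u]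
    ring
  · have hconst : Integrable (fun _ : ℝ => (1 : ℝ)) (volume.restrict (Set.uIoc 0 T)) := by
      simp [isFiniteMeasure_restrict]
    refine ((hconst.mul_prod hf).mul_bdd (c := 1) (g := fun z : ℝ × ℝ => cos (z.2 * z.1))
      (by fun_prop) (.of_forall fun z => by simpa using abs_cos_le_one _)).congr
      (.of_forall fun z => ?_)
    simp [Function.uncurry]

theorem integrable_div_self_of_differentiableAt {f : ℝ → ℝ} (hf : Integrable f)
    (hd : DifferentiableAt ℝ f 0) (h0 : f 0 = 0) : Integrable (fun u => f u / u) := by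
  have hO := hd.hasDerivAt.isBigO_sub
  simp only [h0, sub_zero] at hO
  obtain ⟨C, hC⟩ := hO.bound
  obtain ⟨δ, hδ, hball⟩ := Metric.eventually_nhds_iff.1 hC
  have hC0 : 0 ≤ C := by
    have := hball (y := δ / 2) (by simp [abs_of_pos hδ]; linarith)
    have h1 : 0 ≤ C * ‖δ / 2‖ := (norm_nonneg _).trans this
    exact nonneg_of_mul_nonneg_left h1 (by simpa using hδ.ne')
  have hone : Integrable ((Set.Ioo (-δ) δ).indicator fun _ => C) :=
    (integrable_indicator_iff measurableSet_Ioo).2 (by simp)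
  refine ((hf.norm.const_mul δ⁻¹).add hone).mono'
    (hf.aemeasurable.div aemeasurable_id).aestronglyMeasurable (.of_forall fun u => ?_)
  simp only [Pi.add_apply, norm_div]
  have hfu : 0 ≤ δ⁻¹ * ‖f u‖ := by positivity
  by_cases hu : |u| < δ
  · rw [Set.indicator_of_mem (show u ∈ Set.Ioo (-δ) δ from abs_lt.1 hu)]
    have := div_le_of_le_mul₀ (norm_nonneg u) hC0 (hball (y := u) (by simpa using hu))
    linarith
  · rw [Set.indicator_of_notMem (show u ∉ Set.Ioo (-δ) δ from fun h => hu (abs_lt.2 h)),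
      add_zero, div_eq_inv_mul]
    gcongr
    simpa using hu

theorem integral_exp_neg_sq_mul_cos (t : ℝ) :
    ∫ u : ℝ, exp (-u ^ 2) * cos (u * t) = √π * exp (-(1 / 4) * t ^ 2) := by
  have h := fourierIntegral_gaussian (b := 1) (by simp) (t : ℂ)
  have hint : Integrable (fun u : ℝ =>
      Complex.exp (Complex.I * t * u) * Complex.exp (-1 * u ^ 2)) := by
    by_contra hn
    rw [integral_undef hn] at h
    have : (π : ℂ) ≠ 0 := by simp [pi_ne_zero]
    simp [Complex.cpow_eq_zero_iff, this] at h
  have hre := congrArg Complex.re h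
  rw [← RCLike.re_eq_complex_re, ← integral_re hint] at hre
  have e1 : ((π : ℂ) / 1) ^ (1 / 2 : ℂ) = (√π : ℝ) := by
    rw [sqrt_eq_rpow, Complex.ofReal_cpow pi_pos.le]; simp
  rw [e1, RCLike.re_eq_complex_re, Complex.re_ofReal_mul,
    show -(t : ℂ) ^ 2 / (4 * 1) = ((-(1 / 4) * t ^ 2 : ℝ) : ℂ) by push_cast; ring,
    Complex.exp_ofReal_re] at hre
  rw [← hre]
  refine integral_congr_ae (.of_forall fun u => ?_)
  change _ = (Complex.exp (Complex.I * t * u) * Complex.exp (-1 * u ^ 2)).re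
  rw [show (-1 * (u : ℂ) ^ 2) = ((-u ^ 2 : ℝ) : ℂ) by push_cast; ring,
    show Complex.I * t * u = ((u * t : ℝ) : ℂ) * Complex.I by push_cast; ring,
    ← Complex.ofReal_exp, Complex.re_mul_ofReal, Complex.exp_ofReal_mul_I_re, mul_comm]

theorem integrable_mul_cos {f φ : ℝ → ℝ} (hf : Integrable f) (hφ : Continuous φ) (t : ℝ) :
    Integrable fun u => f u * cos (φ u * t) :=
  hf.mul_bdd (c := 1) (by fun_prop) (.of_forall fun u => by simpa using abs_cos_le_one _)

theorem continuous_integral_mul_cos {f φ : ℝ → ℝ} (hf : Integrable f) (hφ : Continuous φ) :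
    Continuous fun t => ∫ u, f u * cos (φ u * t) :=
  continuous_of_dominated (fun t => (integrable_mul_cos hf hφ t).aestronglyMeasurable)
    (bound := fun u => ‖f u‖)
    (fun t => .of_forall fun u => by
      simpa using mul_le_of_le_one_right (abs_nonneg _) (abs_cos_le_one _))
    hf.norm (.of_forall fun u => by fun_prop)

theorem tendsto_integral_integral_mul_cos_zero {f : ℝ → ℝ} (hf : Integrable f)
    (hd : DifferentiableAt ℝ f 0) :
    Tendsto (fun T : ℝ => ∫ t in 0..T, ∫ u, f u * cos (u * t)) atTop (nhds (π * f 0)) := by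
  have hgauss : Integrable (fun u : ℝ => exp (-u ^ 2)) := by
    simpa using integrable_exp_neg_mul_sq (b := 1) one_pos
  have hrem : Integrable (fun u => f u - f 0 * exp (-u ^ 2)) := hf.sub (hgauss.const_mul _)
  have hremdiv := integrable_div_self_of_differentiableAt hrem
    (hd.sub (by fun_prop)) (by simp)
  have hlim : Tendsto (fun T : ℝ => f 0 * (√π * ∫ t in 0..T, exp (-(1 / 4) * t ^ 2)))
      atTop (nhds (π * f 0)) := by
    have h := intervalIntegral_tendsto_integral_Ioi (0 : ℝ)
      (integrable_exp_neg_mul_sq (b := 1 / 4) (by norm_num)).integrableOn tendsto_id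
    have hval : π * f 0 = f 0 * (√π * (√(π / (1 / 4)) / 2)) := by
      rw [show π / (1 / 4) = π * 2 ^ 2 by ring, sqrt_mul pi_pos.le, sqrt_sq (by norm_num)]
      linear_combination (-f 0) * mul_self_sqrt pi_pos.le
    rw [hval, ← integral_gaussian_Ioi]
    exact (h.const_mul _).const_mul _
  have h := (tendsto_integral_mul_sin_atTop hremdiv).add hlim
  rw [zero_add] at h
  refine h.congr fun T => ?_
  rw [← integral_integral_mul_cos hrem, ← intervalIntegral.integral_const_mul,
    ← intervalIntegral.integral_const_mul, ← intervalIntegral.integral_add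
      ((continuous_integral_mul_cos (φ := fun u => u) hrem continuous_id).intervalIntegrable _ _)
      (Continuous.intervalIntegrable (by fun_prop) _ _)]
  refine intervalIntegral.integral_congr fun t _ => ?_
  rw [← integral_exp_neg_sq_mul_cos, ← integral_const_mul,
    ← integral_add (integrable_mul_cos (φ := fun u => u) hrem continuous_id t)
      ((integrable_mul_cos (φ := fun u => u) hgauss continuous_id t).const_mul _)]
  refine integral_congr_ae (.of_forall fun u => ?_)
  simp only
  ring

/-- Pointwise Fourier inversion at a point of differentiability. -/
theorem tendsto_integral_integral_mul_cos_sub {f : ℝ → ℝ} (hf : Integrable f) {c : ℝ}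
    (hd : DifferentiableAt ℝ f c) :
    Tendsto (fun T : ℝ => ∫ t in 0..T, ∫ u, f u * cos ((u - c) * t)) atTop
      (nhds (π * f c)) := by
  have h := tendsto_integral_integral_mul_cos_zero (f := fun u => f (u + c)) (hf.comp_add_right c)
    ((differentiableAt_comp_add_const).2 (by simpa using hd))
  simp only [zero_add] at h
  refine h.congr fun T => intervalIntegral.integral_congr fun t _ => ?_
  rw [← integral_add_right_eq_self (fun u => f u * cos ((u - c) * t)) c]
  simp

/-- Termwise integration of a double series whose terms integrate to those of a binomial
expansion. -/
theorem hasSum_integral_of_integral_eq_choose {F : ℕ × ℕ → ℝ → ℝ} {b : ℕ × ℕ → ℝ} {f : ℝ → ℝ}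
    {α β P Q : ℝ} {c : ℕ → ℝ} (hF : ∀ p, Continuous (F p)) (hb : Summable b)
    (hbound : ∀ p, ∀ x ∈ Set.uIoc α β, |F p x| ≤ b p)
    (hsum : ∀ x ∈ Set.uIoc α β, HasSum (F · x) (f x))
    (hint : ∀ j k, ∫ x in α..β, F (j, k) x = c (j + k) * ((j + k).choose j * (P ^ j * Q ^ k))) :
    HasSum (fun n => c n * (P + Q) ^ n) (∫ x in α..β, f x) := by
  have h := intervalIntegral.hasSum_integral_of_dominated_convergence (μ := volume)
    (fun p _ => b p) (fun p => (hF p).aestronglyMeasurable) (fun p => .of_forall (hbound p))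
    (.of_forall fun _ _ => hb) (by simp) (.of_forall hsum)
  have h' := (Finset.HasAntidiagonal.sigmaAntidiagonalEquivProd.hasSum_iff.2 h).sigma
    fun n => hasSum_fintype _
  refine h'.congr_fun fun n => ?_
  rw [(Commute.all P Q).add_pow', Finset.mul_sum, Finset.univ_eq_attach,
    ← Finset.sum_attach (Finset.HasAntidiagonal.antidiagonal n)]
  refine Finset.sum_congr rfl fun p _ => ?_
  have hp := Finset.HasAntidiagonal.mem_antidiagonal.1 p.2
  simp only [Function.comp_apply, Finset.HasAntidiagonal.sigmaAntidiagonalEquivProd_apply]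
  have hp' := hint p.1.1 p.1.2
  rw [hp] at hp'
  simpa using hp'.symm

theorem integral_cos_pow_even_mul_sin_pow_even (j k : ℕ) :
    ∫ θ in 0..π, cos θ ^ (2 * j) * sin θ ^ (2 * k) =
      π * (2 * j).factorial * (2 * k).factorial /
        (4 ^ (j + k) * j.factorial * k.factorial * (j + k).factorial) := by
  induction j generalizing k with
  | zero =>
    simp only [mul_zero, pow_zero, one_mul, integral_sin_pow_even]
    induction k with
    | zero => simp
    | succ k ih =>
      rw [Finset.prod_range_succ, ← mul_assoc, ih]
      simp only [mul_add, mul_one, Nat.factorial_succ, zero_add, pow_succ, Nat.factorial_zero]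
      push_cast
      field_simp
      ring
  | succ j ih =>
    have hparts : ∫ θ in 0..π, ((2 * k + 1 : ℝ) * (cos θ ^ (2 * (j + 1)) * sin θ ^ (2 * k)) -
        (2 * j + 1) * (cos θ ^ (2 * j) * sin θ ^ (2 * (k + 1)))) = 0 := by
      rw [intervalIntegral.integral_eq_sub_of_hasDerivAt
        (f := fun θ => cos θ ^ (2 * j + 1) * sin θ ^ (2 * k + 1)) (fun θ _ => ?_)
        (Continuous.intervalIntegrable (by fun_prop) _ _)]
      · simp
      · convert! ((hasDerivAt_cos θ).pow (2 * j + 1)).mul ((hasDerivAt_sin θ).pow (2 * k + 1))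
          using 1
        push_cast
        simp only [Pi.pow_apply]
        ring
    rw [intervalIntegral.integral_sub (Continuous.intervalIntegrable (by fun_prop) _ _)
      (Continuous.intervalIntegrable (by fun_prop) _ _), intervalIntegral.integral_const_mul,
      intervalIntegral.integral_const_mul, ih (k + 1)] at hparts
    have hk : (2 * k + 1 : ℝ) ≠ 0 := by positivity
    apply mul_left_cancel₀ hk
    rw [sub_eq_zero.1 hparts, show j + 1 + k = j + (k + 1) by ring]
    simp only [mul_add, mul_one, Nat.factorial_succ]
    push_cast
    field_simp
    ring

theorem integral_sq_sub_sq_pow_mul_pow (L : ℝ) (j k : ℕ) :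
    ∫ x in 0..L, x ^ (2 * j) * (L ^ 2 - x ^ 2) ^ k =
      L ^ (2 * (j + k) + 1) * (4 ^ k * k.factorial * (2 * j).factorial * (j + k).factorial) /
        (j.factorial * (2 * (j + k) + 1).factorial) := by
  induction k generalizing j with
  | zero =>
    simp [Nat.factorial_succ]
    field_simp
  | succ k ih =>
    have hparts : ∫ x in 0..L, ((2 * j + 1 : ℝ) * (x ^ (2 * j) * (L ^ 2 - x ^ 2) ^ (k + 1)) -
        2 * (k + 1) * (x ^ (2 * (j + 1)) * (L ^ 2 - x ^ 2) ^ k)) = 0 := by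
      rw [intervalIntegral.integral_eq_sub_of_hasDerivAt
        (f := fun x => x ^ (2 * j + 1) * (L ^ 2 - x ^ 2) ^ (k + 1)) (fun x _ => ?_)
        (Continuous.intervalIntegrable (by fun_prop) _ _)]
      · simp
      · convert! (hasDerivAt_pow (2 * j + 1) x).mul
          (((hasDerivAt_pow 2 x).const_sub (L ^ 2)).pow (k + 1)) using 1
        push_cast
        simp only [Pi.pow_apply]
        ring
    rw [intervalIntegral.integral_sub (Continuous.intervalIntegrable (by fun_prop) _ _)
      (Continuous.intervalIntegrable (by fun_prop) _ _), intervalIntegral.integral_const_mul,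
      intervalIntegral.integral_const_mul, ih (j + 1)] at hparts
    have hj : (2 * j + 1 : ℝ) ≠ 0 := by positivity
    apply mul_left_cancel₀ hj
    rw [sub_eq_zero.1 hparts, show j + 1 + k = j + (k + 1) by ring]
    simp only [mul_add, mul_one, Nat.factorial_succ]
    push_cast
    field_simp
    ring

/-- The entire function `s ↦ I₀(√s)`, so that `J₀(z) = besselEntire (-z²)`. -/
def besselEntire (s : ℝ) : ℝ := ∑' k : ℕ, s ^ k / (4 ^ k * (k.factorial : ℝ) ^ 2)

theorem summable_besselEntire (s : ℝ) :
    Summable fun k : ℕ => s ^ k / (4 ^ k * (k.factorial : ℝ) ^ 2) := by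
  refine (Real.summable_pow_div_factorial |s|).of_norm_bounded fun k => ?_
  have h1 : (1 : ℝ) ≤ k.factorial := by exact_mod_cast Nat.one_le_iff_ne_zero.2 k.factorial_ne_zero
  have h4 : (1 : ℝ) ≤ 4 ^ k := one_le_pow₀ (by norm_num)
  rw [norm_div, norm_pow, Real.norm_eq_abs, Real.norm_of_nonneg (by positivity)]
  gcongr
  nlinarith

theorem pow_two_mul_div_factorial_nonneg (x : ℝ) (k : ℕ) :
    0 ≤ x ^ (2 * k) / (2 * k).factorial := by
  rw [pow_mul]; positivity

/-- An integral representation of Bessel type, with real and imaginary frequencies. -/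
theorem besselEntire_eq_integral (p q : ℝ) :
    besselEntire (q ^ 2 - p ^ 2) = π⁻¹ * ∫ θ in 0..π, cos (p * cos θ) * cosh (q * sin θ) := by
  have hpos := pow_two_mul_div_factorial_nonneg
  have h : HasSum (fun n : ℕ => π / (4 ^ n * (n.factorial : ℝ) ^ 2) * (-p ^ 2 + q ^ 2) ^ n)
      (∫ θ in 0..π, cos (p * cos θ) * cosh (q * sin θ)) := by
    refine hasSum_integral_of_integral_eq_choose
      (F := fun m θ => ((-1) ^ m.1 * (p * cos θ) ^ (2 * m.1) / (2 * m.1).factorial) *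
        ((q * sin θ) ^ (2 * m.2) / (2 * m.2).factorial))
      (b := fun m => p ^ (2 * m.1) / (2 * m.1).factorial * (q ^ (2 * m.2) / (2 * m.2).factorial))
      (c := fun n => π / (4 ^ n * (n.factorial : ℝ) ^ 2)) (fun m => by fun_prop)
      ((Real.hasSum_cosh p).summable.mul_of_nonneg (Real.hasSum_cosh q).summable (hpos p) (hpos q))
      (fun m θ _ => ?_) (fun θ _ => ?_) (fun j k => ?_)
    · rw [abs_mul, mul_div_assoc, abs_mul, abs_pow, abs_neg, abs_one, one_pow, one_mul,
        abs_of_nonneg (hpos _ _), abs_of_nonneg (hpos _ _)]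
      have hsq (x y : ℝ) (hy : |y| ≤ 1) (k : ℕ) : (x * y) ^ (2 * k) ≤ x ^ (2 * k) := by
        rw [pow_mul, pow_mul, mul_pow]
        gcongr
        exact mul_le_of_le_one_right (sq_nonneg x) ((sq_le_one_iff_abs_le_one y).2 hy)
      exact mul_le_mul
        (div_le_div_of_nonneg_right (hsq _ _ (abs_cos_le_one θ) _) (by positivity))
        (div_le_div_of_nonneg_right (hsq _ _ (abs_sin_le_one θ) _) (by positivity))
        (hpos _ _) (hpos _ _)
    · exact (Real.hasSum_cos _).mul (Real.hasSum_cosh _)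
        (((Real.hasSum_cosh _).summable.mul_of_nonneg (Real.hasSum_cosh (q * sin θ)).summable (hpos (p * cos θ)) (hpos _)).of_norm_bounded
        fun m => by
          rw [norm_mul, mul_div_assoc, norm_mul, norm_pow, norm_neg, norm_one, one_pow, one_mul,
            Real.norm_of_nonneg (hpos _ _), Real.norm_of_nonneg (hpos _ _)])
    · rw [intervalIntegral.integral_congr (g := fun θ => ((-1) ^ j * p ^ (2 * j) * q ^ (2 * k) /
        ((2 * j).factorial * (2 * k).factorial)) * (cos θ ^ (2 * j) * sin θ ^ (2 * k)))
        (fun θ _ => by simp only [mul_pow]; ring), intervalIntegral.integral_const_mul,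
        integral_cos_pow_even_mul_sin_pow_even, Nat.cast_add_choose, neg_pow (p ^ 2),
        ← pow_mul, ← pow_mul]
      field_simp
  rw [besselEntire, ← h.tsum_eq, ← tsum_mul_left]
  refine tsum_congr fun k => ?_
  rw [neg_add_eq_sub]
  field_simp

theorem continuous_besselEntire_comp (a L : ℝ) :
    Continuous fun x => besselEntire ((a * L) ^ 2 - (a * x) ^ 2) := by
  simp only [besselEntire_eq_integral]
  exact (intervalIntegral.continuous_parametric_intervalIntegral_of_continuous'
    (by fun_prop) _ _).const_mul _

theorem hasSum_integral_cos_mul_besselEntire (a L ξ : ℝ) :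
    HasSum (fun n : ℕ => L ^ (2 * n + 1) / (2 * n + 1).factorial * (-ξ ^ 2 + a ^ 2) ^ n)
      (∫ x in 0..L, cos (x * ξ) * besselEntire ((a * L) ^ 2 - (a * x) ^ 2)) := by
  have hpos := pow_two_mul_div_factorial_nonneg
  have hpos' : ∀ x : ℝ, ∀ k : ℕ, 0 ≤ (x ^ 2) ^ k / (4 ^ k * (k.factorial : ℝ) ^ 2) := fun x k => by
    positivity
  have hs (x : ℝ) := (Real.hasSum_cosh (x * ξ)).summable
  have hbd (y : ℝ) (z : ℝ) (hz : |z| ≤ (a * L) ^ 2) (m : ℕ × ℕ) (hy : y ^ 2 ≤ (L * ξ) ^ 2) :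
      |((-1) ^ m.1 * y ^ (2 * m.1) / (2 * m.1).factorial) *
        (z ^ m.2 / (4 ^ m.2 * (m.2.factorial : ℝ) ^ 2))| ≤
      (L * ξ) ^ (2 * m.1) / (2 * m.1).factorial *
        (((a * L) ^ 2) ^ m.2 / (4 ^ m.2 * (m.2.factorial : ℝ) ^ 2)) := by
    rw [abs_mul, mul_div_assoc, abs_mul, abs_pow, abs_neg, abs_one, one_pow, one_mul,
      abs_of_nonneg (hpos _ _), abs_div, abs_pow, abs_of_pos (by positivity :
        (0 : ℝ) < 4 ^ m.2 * (m.2.factorial : ℝ) ^ 2), pow_mul, pow_mul]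
    gcongr
  have hb := (hs L).mul_of_nonneg (summable_besselEntire ((a * L) ^ 2)) (hpos _) (hpos' _)
  have hx (x : ℝ) (hx : x ∈ Set.uIoc 0 L) : x ^ 2 ≤ L ^ 2 := by
    rw [sq_le_sq]
    rcases Set.mem_uIoc.1 hx with h | h
    · rw [abs_of_pos h.1, abs_of_pos (h.1.trans_le h.2)]; exact h.2
    · rw [abs_of_nonpos h.2, abs_of_neg (h.1.trans_le h.2)]; linarith
  have hxξ (x : ℝ) (h : x ∈ Set.uIoc 0 L) : (x * ξ) ^ 2 ≤ (L * ξ) ^ 2 := by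
    rw [mul_pow, mul_pow]
    exact mul_le_mul_of_nonneg_right (hx x h) (sq_nonneg ξ)
  have hxa (x : ℝ) (h : x ∈ Set.uIoc 0 L) : |(a * L) ^ 2 - (a * x) ^ 2| ≤ (a * L) ^ 2 := by
    have := mul_le_mul_of_nonneg_left (hx x h) (sq_nonneg a)
    rw [abs_le]
    constructor <;> nlinarith [sq_nonneg (a * x), sq_nonneg (a * L)]
  refine hasSum_integral_of_integral_eq_choose
    (F := fun m x => ((-1) ^ m.1 * (x * ξ) ^ (2 * m.1) / (2 * m.1).factorial) *
      (((a * L) ^ 2 - (a * x) ^ 2) ^ m.2 / (4 ^ m.2 * (m.2.factorial : ℝ) ^ 2)))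
    (c := fun n => L ^ (2 * n + 1) / (2 * n + 1).factorial) (fun m => by fun_prop) hb
    (fun m x h => hbd _ _ (hxa x h) m (hxξ x h)) (fun x h => ?_) (fun j k => ?_)
  · exact (Real.hasSum_cos _).mul (summable_besselEntire _).hasSum
      (hb.of_norm_bounded fun m => hbd _ _ (hxa x h) m (hxξ x h))
  · rw [intervalIntegral.integral_congr (g := fun x => ((-1) ^ j * ξ ^ (2 * j) * a ^ (2 * k) /
      ((2 * j).factorial * (4 ^ k * (k.factorial : ℝ) ^ 2))) *
        (x ^ (2 * j) * (L ^ 2 - x ^ 2) ^ k))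
      (fun x _ => by simp only [mul_pow, ← mul_sub, ← pow_mul]; ring),
      intervalIntegral.integral_const_mul,
      integral_sq_sub_sq_pow_mul_pow, Nat.cast_add_choose, neg_pow (ξ ^ 2),
      ← pow_mul, ← pow_mul]
    field_simp

/-- The even spectral density of `x ↦ J₀(a√(x² - L²))`; it vanishes outside `(-a, a)`. -/
def besselDensity (a L y : ℝ) : ℝ := cosh (L * √(a ^ 2 - y ^ 2)) / √(a ^ 2 - y ^ 2)

theorem besselDensity_eq_zero {a L y : ℝ} (h : a ^ 2 ≤ y ^ 2) : besselDensity a L y = 0 := by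
  simp [besselDensity, sqrt_eq_zero_of_nonpos (sub_nonpos.2 h)]

theorem besselDensity_mul_left {a : ℝ} (ha : 0 < a) (L u : ℝ) :
    besselDensity a L (a * u) = a⁻¹ * besselDensity 1 (a * L) u := by
  have h : √(a ^ 2 - (a * u) ^ 2) = a * √(1 ^ 2 - u ^ 2) := by
    rw [show a ^ 2 - (a * u) ^ 2 = a ^ 2 * (1 ^ 2 - u ^ 2) by ring, sqrt_mul (sq_nonneg a),
      sqrt_sq ha.le]
  rw [besselDensity, besselDensity, h, mul_left_comm L, ← mul_assoc, inv_mul_eq_div, div_div,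
    mul_comm a √_]

theorem integrable_besselDensity {a : ℝ} (ha : 0 < a) (L : ℝ) :
    Integrable (besselDensity a L) := by
  have h1 (q : ℝ) : Integrable (besselDensity 1 q) := by
    have h := Polynomial.Chebyshev.intervalIntegrable_sqrt_one_sub_sq_inv.continuousOn_mul
      (g := fun u => cosh (q * √(1 - u ^ 2))) (by fun_prop)
    rw [intervalIntegrable_iff_integrableOn_Ioc_of_le (by norm_num)] at h
    have h' : IntegrableOn (besselDensity 1 q) (Set.Ioc (-1) 1) :=
      h.congr_fun (fun u _ => by simp [besselDensity, div_eq_mul_inv]) measurableSet_Ioc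
    refine h'.integrable_of_forall_notMem_eq_zero fun u hu => besselDensity_eq_zero ?_
    by_contra! hlt
    have := abs_lt.1 ((sq_lt_sq.1 hlt).trans_eq abs_one)
    exact hu ⟨this.1, this.2.le⟩
  have h := ((h1 (a * L)).const_mul a⁻¹)
  simp only [← besselDensity_mul_left ha] at h
  exact (integrable_comp_mul_left_iff _ ha.ne').1 h

theorem differentiableAt_besselDensity {a y : ℝ} (L : ℝ) (h : |y| ≠ |a|) :
    DifferentiableAt ℝ (besselDensity a L) y := by
  rcases lt_or_gt_of_ne h with h | h
  · have hpos : 0 < a ^ 2 - y ^ 2 := sub_pos.2 (sq_lt_sq.2 h)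
    have hs : DifferentiableAt ℝ (fun y => √(a ^ 2 - y ^ 2)) y :=
      DifferentiableAt.sqrt (by fun_prop) hpos.ne'
    exact ((hs.const_mul L).cosh).div hs (sqrt_pos.2 hpos).ne'
  · have hev : besselDensity a L =ᶠ[nhds y] fun _ => 0 := by
      have : ∀ᶠ z in nhds y, |a| < |z| := continuousAt_const.eventually_lt (by fun_prop) h
      filter_upwards [this] with z hz
      exact besselDensity_eq_zero (sq_lt_sq.2 hz).le
    exact (differentiableAt_const 0).congr_of_eventuallyEq hev

theorem besselEntire_eq_integral_besselDensity {a : ℝ} (ha : 0 < a) (L x : ℝ) :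
    besselEntire ((a * L) ^ 2 - (a * x) ^ 2) = π⁻¹ * ∫ y, besselDensity a L y * cos (y * x) := by
  rw [besselEntire_eq_integral]
  congr 1
  calc ∫ θ in 0..π, cos (a * x * cos θ) * cosh (a * L * sin θ)
      = ∫ θ in 0..π, (fun u => cos (a * x * u) * cosh (a * L * √(1 - u ^ 2))) (cos θ) := by
        refine intervalIntegral.integral_congr fun θ hθ => ?_
        rw [Set.uIcc_of_le pi_pos.le] at hθ
        simp only
        rw [← sin_sq, sqrt_sq (sin_nonneg_of_mem_Icc hθ)]
    _ = ∫ u in Set.Ioc (-1) 1, besselDensity 1 (a * L) u * cos (a * u * x) := by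
        rw [← Polynomial.Chebyshev.integral_measureT_eq_integral_cos
            (f := fun u => cos (a * x * u) * cosh (a * L * √(1 - u ^ 2))),
          Polynomial.Chebyshev.integral_measureT, intervalIntegral.integral_of_le (by norm_num)]
        refine integral_congr_ae (.of_forall fun u => ?_)
        simp only [besselDensity, sqrt_inv, one_pow]
        rw [mul_right_comm a u x]
        ring
    _ = ∫ u, besselDensity 1 (a * L) u * cos (a * u * x) := by
        refine setIntegral_eq_integral_of_forall_compl_eq_zero fun u hu => ?_
        rw [besselDensity_eq_zero, zero_mul]
        by_contra! hlt
        have := abs_lt.1 ((sq_lt_sq.1 hlt).trans_eq abs_one)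
        exact hu ⟨this.1, this.2.le⟩
    _ = a * ∫ u, besselDensity a L (a * u) * cos (a * u * x) := by
        rw [← integral_const_mul]
        refine integral_congr_ae (.of_forall fun u => ?_)
        simp only [besselDensity_mul_left ha]
        field_simp
    _ = ∫ y, besselDensity a L y * cos (y * x) := by
        rw [Measure.integral_comp_mul_left (fun y => besselDensity a L y * cos (y * x)) a,
          abs_of_pos (inv_pos.2 ha), smul_eq_mul, mul_inv_cancel_left₀ ha.ne']

theorem tendsto_integral_cos_mul_besselEntire {a ξ : ℝ} (ha : 0 < a) (L : ℝ) (h : |ξ| ≠ a) :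
    Tendsto (fun T : ℝ => ∫ x in 0..T, cos (x * ξ) * besselEntire ((a * L) ^ 2 - (a * x) ^ 2))
      atTop (nhds (besselDensity a L ξ)) := by
  have hg := integrable_besselDensity ha L
  have hd (y : ℝ) (hy : |y| = |ξ|) : DifferentiableAt ℝ (besselDensity a L) y :=
    differentiableAt_besselDensity L (by rwa [hy, abs_of_pos ha])
  have hlim := ((tendsto_integral_integral_mul_cos_sub hg (hd ξ rfl)).add
    (tendsto_integral_integral_mul_cos_sub hg (hd (-ξ) (abs_neg ξ)))).const_mul (2 * π)⁻¹
  have hval : (2 * π)⁻¹ * (π * besselDensity a L ξ + π * besselDensity a L (-ξ)) =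
      besselDensity a L ξ := by
    simp only [besselDensity, neg_sq]
    field_simp
    ring
  rw [hval] at hlim
  refine hlim.congr fun T => ?_
  rw [← intervalIntegral.integral_add
    ((continuous_integral_mul_cos hg (by fun_prop)).intervalIntegrable _ _)
    ((continuous_integral_mul_cos hg (by fun_prop)).intervalIntegrable _ _),
    ← intervalIntegral.integral_const_mul]
  refine intervalIntegral.integral_congr fun x _ => ?_
  rw [besselEntire_eq_integral_besselDensity ha, ← integral_add
    (integrable_mul_cos hg (by fun_prop) x) (integrable_mul_cos hg (by fun_prop) x),
    mul_left_comm, ← integral_const_mul, ← integral_const_mul, ← integral_const_mul]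
  refine integral_congr_ae (.of_forall fun y => ?_)
  simp only
  rw [← mul_add, sub_mul, sub_mul, neg_mul, sub_neg_eq_add, cos_sub, cos_add, mul_comm ξ x, mul_inv]
  ring

theorem J0_mul_sqrt {a L x : ℝ} (hx : L ^ 2 ≤ x ^ 2) :
    J0 (a * √(x ^ 2 - L ^ 2)) = besselEntire ((a * L) ^ 2 - (a * x) ^ 2) := by
  refine tsum_congr fun k => ?_
  rw [pow_mul, pow_mul, mul_pow a, sq_sqrt (sub_nonneg.2 hx), ← mul_pow]
  norm_num
  ring

theorem integral_cos_mul_besselEntire_of_lt {a ξ : ℝ} (L : ℝ) (h : ξ ^ 2 < a ^ 2) :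
    ∫ x in 0..L, cos (x * ξ) * besselEntire ((a * L) ^ 2 - (a * x) ^ 2) =
      sinh (L * √(a ^ 2 - ξ ^ 2)) / √(a ^ 2 - ξ ^ 2) := by
  refine (hasSum_integral_cos_mul_besselEntire a L ξ).unique ?_
  have hr : √(a ^ 2 - ξ ^ 2) ≠ 0 := (sqrt_pos.2 (sub_pos.2 h)).ne'
  refine ((Real.hasSum_sinh _).div_const _).congr_fun fun n => ?_
  rw [neg_add_eq_sub, ← sq_sqrt (sub_pos.2 h).le, sqrt_sq (sqrt_nonneg _)]
  field_simp
  ring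

theorem integral_cos_mul_besselEntire_of_gt {a ξ : ℝ} (L : ℝ) (h : a ^ 2 < ξ ^ 2) :
    ∫ x in 0..L, cos (x * ξ) * besselEntire ((a * L) ^ 2 - (a * x) ^ 2) =
      sin (L * √(ξ ^ 2 - a ^ 2)) / √(ξ ^ 2 - a ^ 2) := by
  refine (hasSum_integral_cos_mul_besselEntire a L ξ).unique ?_
  have hr : √(ξ ^ 2 - a ^ 2) ≠ 0 := (sqrt_pos.2 (sub_pos.2 h)).ne'
  refine ((Real.hasSum_sin _).div_const _).congr_fun fun n => ?_
  rw [show -ξ ^ 2 + a ^ 2 = -(ξ ^ 2 - a ^ 2) by ring, ← sq_sqrt (sub_pos.2 h).le,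
    sqrt_sq (sqrt_nonneg _), neg_pow]
  field_simp
  ring

/-- **Cosine transform of the truncated Bessel kernel (Oberhettinger).**
For `a > 0`, `L > 0`, `ξ ≠ 0` with `|ξ| ≠ a`, the improper integral
`lim_{T→∞} ∫_L^T cos(xξ)·J₀(a√(x²-L²)) dx` exists and equals
`e^{-L√(a²-ξ²)}/√(a²-ξ²)` if `0 < |ξ| < a`, and `-sin(L√(ξ²-a²))/√(ξ²-a²)` if `|ξ| > a`. -/
theorem stmt10 (a L ξ : ℝ) (ha : 0 < a) (hL : 0 < L) (hξ : 0 < |ξ|) (hne : |ξ| ≠ a) :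
    Filter.Tendsto
      (fun T : ℝ => ∫ x in L..T, Real.cos (x * ξ) * J0 (a * Real.sqrt (x ^ 2 - L ^ 2)))
      Filter.atTop
      (nhds (if |ξ| < a then
          Real.exp (-(L * Real.sqrt (a ^ 2 - ξ ^ 2))) / Real.sqrt (a ^ 2 - ξ ^ 2)
        else -(Real.sin (L * Real.sqrt (ξ ^ 2 - a ^ 2)) / Real.sqrt (ξ ^ 2 - a ^ 2)))) := by
  have hlim := (tendsto_integral_cos_mul_besselEntire ha L hne).sub_const
    (∫ x in 0..L, cos (x * ξ) * besselEntire ((a * L) ^ 2 - (a * x) ^ 2))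
  have hval : besselDensity a L ξ -
      ∫ x in 0..L, cos (x * ξ) * besselEntire ((a * L) ^ 2 - (a * x) ^ 2) =
      if |ξ| < a then exp (-(L * √(a ^ 2 - ξ ^ 2))) / √(a ^ 2 - ξ ^ 2)
      else -(sin (L * √(ξ ^ 2 - a ^ 2)) / √(ξ ^ 2 - a ^ 2)) := by
    split_ifs with hlt
    · rw [integral_cos_mul_besselEntire_of_lt L (sq_lt_sq.2 (by rwa [abs_of_pos ha])),
        besselDensity, ← sub_div, cosh_sub_sinh]
    · have hgt : a ^ 2 < ξ ^ 2 :=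
        sq_lt_sq.2 (by rw [abs_of_pos ha]; exact lt_of_le_of_ne (not_lt.1 hlt) hne.symm)
      rw [integral_cos_mul_besselEntire_of_gt L hgt, besselDensity_eq_zero hgt.le, zero_sub]
  rw [hval] at hlim
  refine hlim.congr' ?_
  filter_upwards [eventually_ge_atTop L] with T hT
  have hcont : Continuous fun x => cos (x * ξ) * besselEntire ((a * L) ^ 2 - (a * x) ^ 2) :=
    (by fun_prop : Continuous fun x : ℝ => cos (x * ξ)).mul (continuous_besselEntire_comp a L)
  rw [intervalIntegral.integral_interval_sub_left (hcont.intervalIntegrable _ _)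
    (hcont.intervalIntegrable _ _)]
  refine intervalIntegral.integral_congr fun x hx => ?_
  rw [Set.uIcc_of_le hT] at hx
  simp only [J0_mul_sqrt (pow_le_pow_left₀ hL.le hx.1 2)]
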